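/- Let r₁ = p₁/q₁ and r₂ = p₂/q₂ be distinct rational numbers in lowest terms with p₁ and p₂ nonzero. For i = 1, 2: if two points (θ,η) and (θ',η') of Ŝ(r₁) ∩ Ŝ(r₂) ∩ W* are adjacent in Ŝ(r_i), then |η − η'| = π|p_i|/Δ(r₁,r₂). -/

import Mathlib

open Real

/-- The set `S(p/q) = {(θ,η) : pθ+qη ∈ 2πℤ or pθ+pπ+qη ∈ 2πℤ}`. -/
def Spq (p q : ℤ) : Set (ℝ × ℝ) :=
  {x | (∃ k : ℤ, (p : ℝ) * x.1 + (q : ℝ) * x.2 = 2 * π * k) ∨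
       (∃ k : ℤ, (p : ℝ) * x.1 + (p : ℝ) * π + (q : ℝ) * x.2 = 2 * π * k)}

/-- The set `Ŝ(p/q) = {(θ,η) : pθ+qη ∈ πℤ}`. -/
def Shat (p q : ℤ) : Set (ℝ × ℝ) :=
  {x | ∃ k : ℤ, (p : ℝ) * x.1 + (q : ℝ) * x.2 = π * k}

/-- The open strip `W* = ℝ × (0, 2π)`. -/
def Wstar : Set (ℝ × ℝ) :=
  {x | 0 < x.2 ∧ x.2 < 2 * π}

/-- Two points `a ≠ b` are adjacent in `L` relative to the set `X` of intersection points: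
they lie on the same connected component of `L` and no point of `X` lies strictly
between them. -/
def AdjacentIn (L X : Set (ℝ × ℝ)) (a b : ℝ × ℝ) : Prop :=
  a ≠ b ∧ b ∈ connectedComponentIn L a ∧ ∀ c ∈ X, c ∉ openSegment ℝ a b

/-- The quantity `d₁(r₁,r₂)` of the paper, where `r₁ = p₁/q₁` and `r₂ = p₂/q₂`:
`2π|p₁|/Δ(r₁,r₂)` if `p₂` is even, and `π|p₁|/Δ(r₁,r₂)` if `p₂` is odd
(`d₂(r₁,r₂)` is obtained by swapping the roles of the two fractions). -/
noncomputable def dd (p₁ q₁ p₂ q₂ : ℤ) : ℝ :=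
  if Even p₂ then 2 * π * |(p₁ : ℝ)| / |((p₁ * q₂ - p₂ * q₁ : ℤ) : ℝ)|
  else π * |(p₁ : ℝ)| / |((p₁ * q₂ - p₂ * q₁ : ℤ) : ℝ)|

theorem IsPreconnected.eq_of_forall_eq_mul_intCast {X : Type*} [TopologicalSpace X] {s : Set X}
    (hs : IsPreconnected s) {f : X → ℝ} (hf : ContinuousOn f s) {r : ℝ}
    (hr : ∀ x ∈ s, ∃ k : ℤ, f x = r * k) {a b : X} (ha : a ∈ s) (hb : b ∈ s) : f a = f b := by
  have hcount : (f '' s).Countable := by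
    refine (Set.countable_range fun k : ℤ => r * (k : ℝ)).mono ?_
    rintro _ ⟨x, hx, rfl⟩
    obtain ⟨k, hk⟩ := hr x hx
    exact ⟨k, hk.symm⟩
  exact hcount.isTotallyDisconnected _ subset_rfl (hs.image f hf)
    (Set.mem_image_of_mem f ha) (Set.mem_image_of_mem f hb)

theorem convex_Wstar : Convex ℝ Wstar :=
  (convex_Ioo (0 : ℝ) (2 * π)).linear_preimage (LinearMap.snd ℝ ℝ ℝ)

theorem eq_of_mem_connectedComponentIn_Shat {p q : ℤ} {a b : ℝ × ℝ}
    (ha : a ∈ Shat p q ∩ Wstar) (hb : b ∈ connectedComponentIn (Shat p q ∩ Wstar) a) :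
    (p : ℝ) * a.1 + q * a.2 = p * b.1 + q * b.2 :=
  isPreconnected_connectedComponentIn.eq_of_forall_eq_mul_intCast
    (f := fun x : ℝ × ℝ => (p : ℝ) * x.1 + q * x.2) (by fun_prop)
    (fun _ hx => (connectedComponentIn_subset _ _ hx).1)
    (mem_connectedComponentIn ha) hb

theorem abs_snd_sub_snd_of_adjacentIn {p₁ q₁ p₂ q₂ : ℤ} (hne : p₁ * q₂ ≠ p₂ * q₁)
    {a b : ℝ × ℝ} (ha : a ∈ Shat p₁ q₁ ∩ Shat p₂ q₂ ∩ Wstar)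
    (hb : b ∈ Shat p₁ q₁ ∩ Shat p₂ q₂ ∩ Wstar)
    (hab : AdjacentIn (Shat p₁ q₁ ∩ Wstar) (Shat p₁ q₁ ∩ Shat p₂ q₂ ∩ Wstar) a b) :
    |a.2 - b.2| = π * |(p₁ : ℝ)| / |((p₁ * q₂ - p₂ * q₁ : ℤ) : ℝ)| := by
  obtain ⟨hne_ab, hconn, hbetween⟩ := hab
  have hline := eq_of_mem_connectedComponentIn_Shat ⟨ha.1.1, ha.2⟩ hconn
  obtain ⟨⟨⟨k, hk⟩, m, hm⟩, haW⟩ := ha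
  obtain ⟨⟨-, m', hm'⟩, hbW⟩ := hb
  have hD : ((p₁ * q₂ - p₂ * q₁ : ℤ) : ℝ) ≠ 0 := by exact_mod_cast sub_ne_zero.mpr hne
  have hsnd : ((p₁ * q₂ - p₂ * q₁ : ℤ) : ℝ) * (a.2 - b.2) = π * p₁ * ((m - m' : ℤ) : ℝ) := by
    push_cast
    linear_combination (p₁ : ℝ) * (hm - hm') - (p₂ : ℝ) * hline
  have hfst : ((p₁ * q₂ - p₂ * q₁ : ℤ) : ℝ) * (a.1 - b.1) = -(π * q₁ * ((m - m' : ℤ) : ℝ)) := by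
    push_cast
    linear_combination (q₂ : ℝ) * hline - (q₁ : ℝ) * (hm - hm')
  have hn0 : m - m' ≠ 0 := by
    intro h
    rw [h] at hsnd hfst
    simp only [Int.cast_zero, mul_zero, neg_zero, mul_eq_zero, hD, false_or] at hsnd hfst
    exact hne_ab (Prod.ext (sub_eq_zero.mp hfst) (sub_eq_zero.mp hsnd))
  have hn1 : |m - m'| = 1 := by
    by_contra h
    have h2 : 1 < |m - m'| := lt_of_le_of_ne (Int.one_le_abs hn0) (Ne.symm h)
    have h2R : (1 : ℝ) < |((m - m' : ℤ) : ℝ)| := by exact_mod_cast h2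
    set t : ℝ := |((m - m' : ℤ) : ℝ)|⁻¹ with ht
    have ht0 : 0 < t := inv_pos.mpr (by linarith)
    have ht1 : t < 1 := inv_lt_one_of_one_lt₀ h2R
    have hsign : t * ((m - m' : ℤ) : ℝ) = ((m - m').sign : ℤ) := by
      have h3 : (((m - m').sign : ℤ) : ℝ) * |((m - m' : ℤ) : ℝ)| = ((m - m' : ℤ) : ℝ) := by
        exact_mod_cast Int.sign_mul_abs (m - m')
      rw [ht, inv_mul_eq_div, div_eq_iff (by linarith), h3]
    have hseg : (1 - t) • a + t • b ∈ openSegment ℝ a b :=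
      ⟨1 - t, t, by linarith, ht0, by ring, rfl⟩
    refine hbetween _ ⟨⟨⟨k, ?_⟩, m - (m - m').sign, ?_⟩, ?_⟩ hseg
    · simp only [Prod.fst_add, Prod.snd_add, Prod.smul_fst, Prod.smul_snd, smul_eq_mul]
      linear_combination hk - t * hline
    · rw [Int.cast_sub, ← hsign]
      simp only [Prod.fst_add, Prod.snd_add, Prod.smul_fst, Prod.smul_snd, smul_eq_mul]
      push_cast
      linear_combination (1 - t) * hm + t * hm'
    · exact convex_Wstar.openSegment_subset haW hbW hseg
  have hn1R : |((m - m' : ℤ) : ℝ)| = 1 := by exact_mod_cast hn1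
  rw [eq_div_iff (abs_ne_zero.mpr hD), mul_comm, ← abs_mul, hsnd, abs_mul, abs_mul, hn1R,
    abs_of_pos pi_pos, mul_one]

/-- If two points of `Ŝ(r₁) ∩ Ŝ(r₂) ∩ W*` are adjacent in `Ŝ(rᵢ)`, then their heights
differ by exactly `π|pᵢ|/Δ(r₁,r₂)`. -/
theorem statement_7 (p₁ q₁ p₂ q₂ : ℤ) (hq₁ : q₁ ≠ 0) (hq₂ : q₂ ≠ 0)
    (hp₁ : p₁ ≠ 0) (hp₂ : p₂ ≠ 0)
    (hc₁ : IsCoprime p₁ q₁) (hc₂ : IsCoprime p₂ q₂)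
    (hne : p₁ * q₂ ≠ p₂ * q₁) :
    (∀ a b : ℝ × ℝ, a ∈ Shat p₁ q₁ ∩ Shat p₂ q₂ ∩ Wstar → b ∈ Shat p₁ q₁ ∩ Shat p₂ q₂ ∩ Wstar →
      AdjacentIn (Shat p₁ q₁ ∩ Wstar) (Shat p₁ q₁ ∩ Shat p₂ q₂ ∩ Wstar) a b →
      |a.2 - b.2| = π * |(p₁ : ℝ)| / |((p₁ * q₂ - p₂ * q₁ : ℤ) : ℝ)|) ∧
    (∀ a b : ℝ × ℝ, a ∈ Shat p₁ q₁ ∩ Shat p₂ q₂ ∩ Wstar → b ∈ Shat p₁ q₁ ∩ Shat p₂ q₂ ∩ Wstar →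
      AdjacentIn (Shat p₂ q₂ ∩ Wstar) (Shat p₁ q₁ ∩ Shat p₂ q₂ ∩ Wstar) a b →
      |a.2 - b.2| = π * |(p₂ : ℝ)| / |((p₁ * q₂ - p₂ * q₁ : ℤ) : ℝ)|) := by
  refine ⟨fun a b ha hb hab => abs_snd_sub_snd_of_adjacentIn hne ha hb hab,
    fun a b ha hb hab => ?_⟩
  rw [Set.inter_comm (Shat p₁ q₁)] at ha hb hab
  rw [abs_snd_sub_snd_of_adjacentIn hne.symm ha hb hab, ← neg_sub (p₁ * q₂), Int.cast_neg, abs_neg]
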